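/- Let K = ℂ and let f be a ℂ-algebra endomorphism of ℂ[x,y] with Jac(P,Q) a nonzero scalar, where P = f(x), Q = f(y). If at least one of the following holds — P is symmetric with respect to α, P is skew-symmetric with respect to α, Q is symmetric with respect to α, or Q is skew-symmetric with respect to α — then f is a ℂ-algebra automorphism of ℂ[x,y]. -/

import Mathlib

open MvPolynomial

/-- The Jacobian of two polynomials in `K[x,y]` (variables indexed by `Fin 2`). -/
noncomputable def Jac {K : Type*} [CommRing K]
    (P Q : MvPolynomial (Fin 2) K) : MvPolynomial (Fin 2) K :=
  pderiv 0 P * pderiv 1 Q - pderiv 1 P * pderiv 0 Q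

/-- The exchange involution `α` on `K[x,y]`, swapping the two variables. -/
noncomputable def exch (K : Type*) [CommSemiring K] :
    MvPolynomial (Fin 2) K ≃ₐ[K] MvPolynomial (Fin 2) K :=
  MvPolynomial.renameEquiv K (Equiv.swap 0 1)

/-- An involution on a `K`-algebra: an algebra automorphism of order 2. -/
def IsInvolution {K R : Type*} [CommSemiring K] [Semiring R] [Algebra K R]
    (γ : R ≃ₐ[K] R) : Prop :=
  (∀ p, γ (γ p) = p) ∧ γ ≠ AlgEquiv.refl

/-- Restriction to the line `v = 0`. -/
noncomputable def resLine : MvPolynomial (Fin 2) ℂ →ₐ[ℂ] Polynomial ℂ :=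
  aeval ![Polynomial.X, 0]

lemma resLine_X0 : resLine (X 0) = Polynomial.X := by simp [resLine]
lemma resLine_X1 : resLine (X 1) = 0 := by simp [resLine]

lemma coeff_resLine (p : MvPolynomial (Fin 2) ℂ) (m : Fin 2 →₀ ℕ) (hm : m 1 = 0) :
    (resLine p).coeff (m 0) = coeff m p := by
  induction p using MvPolynomial.induction_on' with
  | monomial n r =>
    rw [resLine, aeval_monomial, coeff_monomial, Finsupp.prod_fintype _ _ (by simp)]
    simp only [Fin.prod_univ_two, Polynomial.algebraMap_apply, Algebra.algebraMap_self,
      RingHom.id_apply, Matrix.cons_val_zero, Matrix.cons_val_one]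
    by_cases h1 : n 1 = 0
    · rw [h1, pow_zero, mul_one, Polynomial.coeff_C_mul_X_pow]
      have : m 0 = n 0 ↔ n = m := by
        constructor
        · intro h; ext i; fin_cases i
          · exact h.symm
          · exact h1.trans hm.symm
        · rintro rfl; rfl
      simp only [this]
    · rw [zero_pow h1, mul_zero, mul_zero, Polynomial.coeff_zero, if_neg]
      rintro rfl; exact h1 hm
  | add p q hp hq => simp [hp, hq]

lemma resLine_pderiv_zero (p : MvPolynomial (Fin 2) ℂ) :
    resLine (pderiv 0 p) = Polynomial.derivative (resLine p) := by
  induction p using MvPolynomial.induction_on with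
  | C a => simp [resLine]
  | add p q hp hq => simp [hp, hq]
  | mul_X p n hp =>
    fin_cases n <;> simp [pderiv_X, hp, resLine_X0, resLine_X1] <;> ring

lemma coeff_X_mul_pderiv (p : MvPolynomial (Fin 2) ℂ) (i : Fin 2) (m : Fin 2 →₀ ℕ) :
    coeff m (X i * pderiv i p) = (m i : ℂ) * coeff m p := by
  induction p using MvPolynomial.induction_on' with
  | monomial n r =>
    rw [X_mul_pderiv_monomial, coeff_smul, coeff_monomial]
    split_ifs with h
    · subst h; simp
    · simp
  | add p q hp hq => simp [mul_add, hp, hq]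

lemma coeff_Jac (A B : MvPolynomial (Fin 2) ℂ) (e : Fin 2 →₀ ℕ) :
    coeff e (X 0 * X 1 * Jac A B) = ∑ x ∈ Finset.HasAntidiagonal.antidiagonal e,
      ((x.1 0 : ℂ) * x.2 1 - x.1 1 * x.2 0) * (coeff x.1 A * coeff x.2 B) := by
  have : X 0 * X 1 * Jac A B = (X 0 * pderiv 0 A) * (X 1 * pderiv 1 B)
      - (X 1 * pderiv 1 A) * (X 0 * pderiv 0 B) := by
    unfold Jac; ring
  rw [this, coeff_sub, coeff_mul, coeff_mul, ← Finset.sum_sub_distrib]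
  refine Finset.sum_congr rfl fun x _ => ?_
  simp only [coeff_X_mul_pderiv]
  ring

lemma fs_ext {m n : Fin 2 →₀ ℕ} (h0 : m 0 = n 0) (h1 : m 1 = n 1) : m = n := by
  ext i; fin_cases i
  · exact h0
  · exact h1

lemma const_of_mul {p q : Polynomial ℂ} {c : ℂ} (hc : c ≠ 0) (h : p * q = Polynomial.C c) :
    ∃ a : ℂ, a ≠ 0 ∧ p = Polynomial.C a := by
  have hu : IsUnit p := by
    apply isUnit_of_mul_isUnit_left (y := q)
    rw [h]; exact Polynomial.isUnit_C.2 (isUnit_iff_ne_zero.2 hc)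
  obtain ⟨a, ha, rfl⟩ := Polynomial.isUnit_iff.1 hu
  exact ⟨a, ha.ne_zero, rfl⟩

set_option maxHeartbeats 1000000 in
/-- The Newton polygon argument. -/
lemma newton (A B : MvPolynomial (Fin 2) ℂ) (c : ℂ) (hJ : Jac A B = C c)
    (hA0 : ∀ m, m 1 = 0 → coeff m A ≠ 0 → m 0 ≤ 1)
    (hA1 : ∃ m, m 0 = 1 ∧ m 1 = 0 ∧ coeff m A ≠ 0)
    (hB0 : ∀ m, coeff m B ≠ 0 → 1 ≤ m 1)
    (hB1 : ∀ m, coeff m B ≠ 0 → m 1 = 1 → m 0 = 0)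
    (hB2 : ∃ m, m 0 = 0 ∧ m 1 = 1 ∧ coeff m B ≠ 0) :
    (∀ m, coeff m A ≠ 0 → (m 0 = 1 ∧ m 1 = 0) ∨ m 0 = 0) ∧
    (∀ m, coeff m B ≠ 0 → m 0 = 0 ∧ m 1 = 1) := by
  classical
  let T : Finset ℚ := insert 0 (A.support.image (fun m => ((m 0 : ℚ) - 1) / (m 1 : ℚ)) ∪
    B.support.image (fun m => (m 0 : ℚ) / ((m 1 : ℚ) - 1)))
  have hT : T.Nonempty := ⟨0, by simp [T]⟩
  obtain ⟨s, hsT, hsmax⟩ := T.exists_max_image id hT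
  simp only [id] at hsmax
  have hs0 : 0 ≤ s := hsmax 0 (by simp [T])
  have hAs : ∀ m, coeff m A ≠ 0 → (m 0 : ℚ) - 1 ≤ s * m 1 := by
    intro m hm
    by_cases h1 : m 1 = 0
    · have := hA0 m h1 hm
      have h2 : (m 0 : ℚ) ≤ 1 := by exact_mod_cast this
      simp [h1]; linarith
    · have hpos : (0 : ℚ) < m 1 := by exact_mod_cast Nat.pos_of_ne_zero h1
      have := hsmax (((m 0 : ℚ) - 1) / (m 1 : ℚ)) (by
        refine Finset.mem_insert_of_mem (Finset.mem_union_left _ ?_)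
        exact Finset.mem_image.2 ⟨m, mem_support_iff.2 hm, rfl⟩)
      rwa [div_le_iff₀ hpos] at this
  have hBs : ∀ m, coeff m B ≠ 0 → (m 0 : ℚ) ≤ s * ((m 1 : ℚ) - 1) := by
    intro m hm
    by_cases h1 : m 1 = 1
    · have := hB1 m hm h1
      simp [h1, this]
    · have h2 : 1 < m 1 := lt_of_le_of_ne (hB0 m hm) (Ne.symm h1)
      have hpos : (0 : ℚ) < (m 1 : ℚ) - 1 := by
        have : (1 : ℚ) < m 1 := by exact_mod_cast h2
        linarith
      have := hsmax ((m 0 : ℚ) / ((m 1 : ℚ) - 1)) (by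
        refine Finset.mem_insert_of_mem (Finset.mem_union_right _ ?_)
        exact Finset.mem_image.2 ⟨m, mem_support_iff.2 hm, rfl⟩)
      rwa [div_le_iff₀ hpos] at this
  obtain ⟨mA, hmA0, hmA1, hmA⟩ := hA1
  obtain ⟨mB, hmB0, hmB1, hmB⟩ := hB2
  obtain ⟨a, ha, hamax⟩ := (A.support.filter (fun m => (m 0 : ℚ) - 1 = s * m 1)).exists_max_image
    (fun m => m 1) ⟨mA, by simp [hmA0, hmA1, hmA]⟩
  obtain ⟨b, hb, hbmax⟩ := (B.support.filter
    (fun m => (m 0 : ℚ) = s * ((m 1 : ℚ) - 1))).exists_max_image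
    (fun m => m 1) ⟨mB, by simp [hmB0, hmB1, hmB]⟩
  simp only [Finset.mem_filter, mem_support_iff] at ha hb hamax hbmax
  have hco : coeff (a + b) (X 0 * X 1 * Jac A B) =
      ((a 0 : ℂ) * b 1 - a 1 * b 0) * (coeff a A * coeff b B) := by
    rw [coeff_Jac, Finset.sum_eq_single (a, b)]
    · rintro ⟨p, q⟩ hpq hne
      by_contra hcon
      have hpA : coeff p A ≠ 0 := fun h => hcon (by simp [h])
      have hqB : coeff q B ≠ 0 := fun h => hcon (by simp [h])
      rw [Finset.HasAntidiagonal.mem_antidiagonal] at hpq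
      have e0 : p 0 + q 0 = a 0 + b 0 := by simpa using DFunLike.congr_fun hpq 0
      have e1 : p 1 + q 1 = a 1 + b 1 := by simpa using DFunLike.congr_fun hpq 1
      have e0' : (p 0 : ℚ) + q 0 = a 0 + b 0 := by exact_mod_cast e0
      have e1' : (p 1 : ℚ) + q 1 = a 1 + b 1 := by exact_mod_cast e1
      have e1'' : s * (p 1 : ℚ) + s * q 1 = s * a 1 + s * b 1 := by
        rw [← mul_add, e1', mul_add]
      have i1 := hAs p hpA
      have i2 := hBs q hqB
      have j1 := ha.2
      have j2 := hb.2
      rw [mul_sub] at i2 j2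
      have k1 : (p 0 : ℚ) - 1 = s * p 1 := by linarith
      have k2 : (q 0 : ℚ) = s * ((q 1 : ℚ) - 1) := by rw [mul_sub]; linarith
      have l1 := hamax p ⟨hpA, k1⟩
      have l2 := hbmax q ⟨hqB, k2⟩
      have p1 : p 1 = a 1 := by omega
      have q1 : q 1 = b 1 := by omega
      have p0 : p 0 = a 0 := by
        have : (p 0 : ℚ) = a 0 := by rw [p1] at k1; linarith
        exact_mod_cast this
      have q0 : q 0 = b 0 := by omega
      exact hne (by rw [fs_ext p0 p1, fs_ext q0 q1])
    · intro h
      exfalso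
      apply h
      rw [Finset.HasAntidiagonal.mem_antidiagonal]
  have hb1 : 1 ≤ b 1 := hB0 b hb.1
  have hne : coeff (a + b) (X 0 * X 1 * Jac A B) ≠ 0 := by
    rw [hco]
    refine mul_ne_zero ?_ (mul_ne_zero ha.1 hb.1)
    have hq : (a 0 : ℚ) * b 1 - a 1 * b 0 ≠ 0 := by
      have h1 : (a 0 : ℚ) = 1 + s * a 1 := by linarith [ha.2]
      rw [h1, hb.2]
      have hb1' : (1 : ℚ) ≤ b 1 := by exact_mod_cast hb1
      have : 0 ≤ s * a 1 := by positivity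
      have e : (1 + s * (a 1 : ℚ)) * b 1 - a 1 * (s * ((b 1 : ℚ) - 1)) = b 1 + s * a 1 := by ring
      rw [e]
      linarith
    exact_mod_cast hq
  have hab : a 1 + b 1 = 1 := by
    by_contra hcon
    apply hne
    have : (X 0 * X 1 * Jac A B : MvPolynomial (Fin 2) ℂ)
        = monomial (Finsupp.single 0 1 + Finsupp.single 1 1) c := by
      rw [hJ, X, X, monomial_mul, mul_comm, C_mul_monomial]; simp
    rw [this, coeff_monomial, if_neg]
    intro h
    apply hcon
    have := DFunLike.congr_fun h 1
    simpa using this.symm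
  have ha1 : a 1 = 0 := by omega
  have hb1 : b 1 = 1 := by omega
  have hAeq : ∀ m, coeff m A ≠ 0 → (m 0 : ℚ) - 1 = s * m 1 → m 0 = 1 ∧ m 1 = 0 := by
    intro m hm h
    have := hamax m ⟨hm, h⟩
    have h1 : m 1 = 0 := by omega
    refine ⟨?_, h1⟩
    rw [h1] at h
    have : (m 0 : ℚ) = 1 := by simp at h; linarith
    exact_mod_cast this
  have hBeq : ∀ m, coeff m B ≠ 0 → (m 0 : ℚ) = s * ((m 1 : ℚ) - 1) → m 0 = 0 ∧ m 1 = 1 := by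
    intro m hm h
    have := hbmax m ⟨hm, h⟩
    have h2 := hB0 m hm
    have h1 : m 1 = 1 := by omega
    exact ⟨hB1 m hm h1, h1⟩
  have hs : s = 0 := by
    simp only [T, Finset.mem_insert, Finset.mem_union, Finset.mem_image, mem_support_iff] at hsT
    rcases hsT with h | ⟨m, hm, h⟩ | ⟨m, hm, h⟩
    · exact h
    · by_cases h1 : m 1 = 0
      · rw [← h, h1]; simp
      · have h1' : (m 1 : ℚ) ≠ 0 := by exact_mod_cast h1
        exact absurd (hAeq m hm ((div_eq_iff h1').1 h)).2 h1
    · by_cases h1 : m 1 = 1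
      · rw [← h, h1]; simp
      · have h1' : (m 1 : ℚ) - 1 ≠ 0 := by
          rw [sub_ne_zero]; exact_mod_cast h1
        exact absurd (hBeq m hm ((div_eq_iff h1').1 h)).2 h1
  subst hs
  constructor
  · intro m hm
    have h := hAs m hm
    rw [zero_mul] at h
    have h' : m 0 ≤ 1 := by
      have : (m 0 : ℚ) ≤ 1 := by linarith
      exact_mod_cast this
    rcases Nat.lt_or_ge (m 0) 1 with h2 | h2
    · right; omega
    · left
      have h3 : m 0 = 1 := by omega
      exact hAeq m hm (by rw [h3]; simp)
  · intro m hm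
    have h := hBs m hm
    apply hBeq m hm
    rw [zero_mul] at h ⊢
    exact le_antisymm h (by positivity)

lemma main_line (A B : MvPolynomial (Fin 2) ℂ) (c : ℂ) (hc : c ≠ 0) (hJ : Jac A B = C c)
    (hB : resLine B = 0) (S : Subalgebra ℂ (MvPolynomial (Fin 2) ℂ)) (hAS : A ∈ S)
    (hBS : B ∈ S) : S = ⊤ := by
  have hmul : resLine (pderiv 0 A) * resLine (pderiv 1 B) = Polynomial.C c := by
    have := congrArg resLine hJ
    rw [Jac, map_sub, map_mul, map_mul, resLine_pderiv_zero B, hB] at this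
    simpa [resLine] using this
  obtain ⟨a, ha, hau⟩ := const_of_mul hc hmul
  obtain ⟨b, hb, hbv⟩ := const_of_mul hc ((mul_comm _ _).trans hmul)
  have cA : ∀ m : Fin 2 →₀ ℕ, m 1 = 0 →
      coeff (m + Finsupp.single 0 1) A * ((m 0 : ℂ) + 1) = if m 0 = 0 then a else 0 := by
    intro m hm
    have := coeff_resLine (pderiv 0 A) m hm
    rw [hau, Polynomial.coeff_C, coeff_pderiv] at this
    exact this.symm
  have cB : ∀ m : Fin 2 →₀ ℕ, m 1 = 0 →
      coeff (m + Finsupp.single 1 1) B = if m 0 = 0 then b else 0 := by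
    intro m hm
    have := coeff_resLine (pderiv 1 B) m hm
    rw [hbv, Polynomial.coeff_C, coeff_pderiv, hm] at this
    simpa using this.symm
  have cA1 : coeff (Finsupp.single 0 1) A = a := by simpa using cA 0 rfl
  have cB1 : coeff (Finsupp.single 1 1) B = b := by simpa using cB 0 rfl
  obtain ⟨nA, nB⟩ := newton A B c hJ
    (by
      intro m hm h
      by_contra hcon
      apply h
      have e : m = Finsupp.single 0 (m 0 - 1) + Finsupp.single 0 1 :=
        fs_ext (by simp; omega) (by simp [hm])
      have := cA (Finsupp.single 0 (m 0 - 1)) (by simp)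
      rw [← e, if_neg (by simp; omega)] at this
      rcases mul_eq_zero.1 this with h | h
      · exact h
      · exact absurd h (Nat.cast_add_one_ne_zero _))
    ⟨Finsupp.single 0 1, by simp, by simp, by rw [cA1]; exact ha⟩
    (by
      intro m h
      by_contra hcon
      apply h
      rw [← coeff_resLine B m (by omega), hB, Polynomial.coeff_zero])
    (by
      intro m h hm
      by_contra hcon
      apply h
      have e : m = Finsupp.single 0 (m 0) + Finsupp.single 1 1 :=
        fs_ext (by simp) (by simp [hm])
      have := cB (Finsupp.single 0 (m 0)) (by simp)
      rw [← e, if_neg (by simpa using hcon)] at this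
      exact this)
    ⟨Finsupp.single 1 1, by simp, by simp, by rw [cB1]; exact hb⟩
  have hBX : B = b • X 1 := by
    ext m
    rw [coeff_smul, coeff_X]
    by_cases h : Finsupp.single 1 1 = m
    · subst h; simp [cB1]
    · rw [if_neg h, smul_zero]
      by_contra hcon
      obtain ⟨h0, h1⟩ := nB m hcon
      exact h (fs_ext (by simp [h0]) (by simp [h1]))
  have hX1 : X 1 ∈ S := by
    have : (X 1 : MvPolynomial (Fin 2) ℂ) = b⁻¹ • B := by rw [hBX, smul_smul, inv_mul_cancel₀ hb, one_smul]
    rw [this]; exact S.smul_mem hBS _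
  have hR : A - a • X 0 ∈ S := by
    rw [← support_sum_monomial_coeff (A - a • X 0)]
    refine S.sum_mem fun m hm => ?_
    have hm0 : m 0 = 0 := by
      rw [mem_support_iff, coeff_sub, coeff_smul, coeff_X] at hm
      by_cases h : Finsupp.single 0 1 = m
      · subst h; simp [cA1] at hm
      · rw [if_neg h, smul_zero, sub_zero] at hm
        rcases nA m hm with ⟨h0, h1⟩ | h0
        · exact absurd (fs_ext (by simp [h0]) (by simp [h1])) h
        · exact h0
    rw [monomial_eq, Finsupp.prod_fintype _ _ (by simp), Fin.prod_univ_two, hm0, pow_zero, one_mul]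
    exact S.mul_mem (S.algebraMap_mem _) (S.pow_mem hX1 _)
  have hX0 : X 0 ∈ S := by
    have : (X 0 : MvPolynomial (Fin 2) ℂ) = a⁻¹ • (A - (A - a • X 0)) := by
      rw [sub_sub_cancel, smul_smul, inv_mul_cancel₀ ha, one_smul]
    rw [this]; exact S.smul_mem (S.sub_mem hAS hR) _
  rw [eq_top_iff, ← adjoin_range_X, Algebra.adjoin_le_iff]
  rintro _ ⟨i, rfl⟩
  fin_cases i
  · exact hX0
  · exact hX1

/-- Chain rule. -/
lemma chain (g : MvPolynomial (Fin 2) ℂ →ₐ[ℂ] MvPolynomial (Fin 2) ℂ) (i : Fin 2)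
    (p : MvPolynomial (Fin 2) ℂ) :
    pderiv i (g p) = g (pderiv 0 p) * pderiv i (g (X 0)) + g (pderiv 1 p) * pderiv i (g (X 1)) := by
  induction p using MvPolynomial.induction_on with
  | C a => simp [← algebraMap_eq]
  | add p q hp hq => simp only [map_add, hp, hq]; ring
  | mul_X p n hp =>
    fin_cases n <;> simp [pderiv_X, hp] <;> ring

lemma Jac_chain (g : MvPolynomial (Fin 2) ℂ →ₐ[ℂ] MvPolynomial (Fin 2) ℂ)
    (p q : MvPolynomial (Fin 2) ℂ) : Jac (g p) (g q) = g (Jac p q) * Jac (g (X 0)) (g (X 1)) := by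
  unfold Jac
  rw [chain g 0 p, chain g 1 p, chain g 0 q, chain g 1 q]
  simp only [map_sub, map_mul]
  ring

lemma Jac_swap (p q : MvPolynomial (Fin 2) ℂ) : Jac p q = - Jac q p := by
  unfold Jac; ring

/-- Case where the normal derivative of `P` vanishes on the line. -/
lemma main_sym (P Q : MvPolynomial (Fin 2) ℂ) (c : ℂ) (hc : c ≠ 0) (hJ : Jac P Q = C c)
    (hP : resLine (pderiv 1 P) = 0) (S : Subalgebra ℂ (MvPolynomial (Fin 2) ℂ)) (hPS : P ∈ S)
    (hQS : Q ∈ S) : S = ⊤ := by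
  have hmul : resLine (pderiv 0 P) * resLine (pderiv 1 Q) = Polynomial.C c := by
    have := congrArg resLine hJ
    rw [Jac, map_sub, map_mul, map_mul, hP] at this
    simpa [resLine] using this
  obtain ⟨a, ha, hau⟩ := const_of_mul hc hmul
  rw [resLine_pderiv_zero] at hau
  obtain ⟨b, hb⟩ : ∃ b : ℂ, resLine P = Polynomial.C a * Polynomial.X + Polynomial.C b := by
    have : Polynomial.derivative (resLine P - Polynomial.C a * Polynomial.X) = 0 := by
      simp [hau]
    have h2 := Polynomial.eq_C_of_derivative_eq_zero this
    exact ⟨_, (sub_eq_iff_eq_add'.1 h2)⟩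
  let τ : MvPolynomial (Fin 2) ℂ →ₐ[ℂ] MvPolynomial (Fin 2) ℂ := aeval ![C a⁻¹ * (P - C b), 0]
  have τ0 : τ (X 0) = C a⁻¹ * (P - C b) := by simp [τ]
  have τ1 : τ (X 1) = 0 := by simp [τ]
  have hres : ∀ q, resLine (τ q) = resLine q := by
    intro q
    have : resLine.comp τ = resLine := by
      apply MvPolynomial.algHom_ext
      intro i
      fin_cases i
      · have hC : ∀ z : ℂ, resLine (C z) = Polynomial.C z := fun z => by simp [resLine]
        simp only [AlgHom.comp_apply, Fin.zero_eta]
        rw [τ0, map_mul, map_sub, hb, hC, hC, resLine_X0, add_sub_cancel_right, ← mul_assoc,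
          ← Polynomial.C_mul, inv_mul_cancel₀ ha, Polynomial.C_1, one_mul]
      · simp only [AlgHom.comp_apply, Fin.mk_one]
        rw [τ1, resLine_X1, map_zero]
    exact DFunLike.congr_fun this q
  have hτS : ∀ q, τ q ∈ S := by
    intro q
    have hX0 : τ (X 0) ∈ S := by
      rw [τ0]
      exact S.mul_mem (S.algebraMap_mem _) (S.sub_mem hPS (S.algebraMap_mem _))
    induction q using MvPolynomial.induction_on with
    | C z => rw [← algebraMap_eq, AlgHom.commutes]; exact S.algebraMap_mem _
    | add p q hp hq => rw [map_add]; exact S.add_mem hp hq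
    | mul_X p n hp =>
      rw [map_mul]
      refine S.mul_mem hp ?_
      fin_cases n
      · exact hX0
      · simp only [Fin.mk_one]; rw [τ1]; exact S.zero_mem
  refine main_line P (Q - τ Q) c hc ?_ (by rw [map_sub, hres, sub_self]) S hPS
    (S.sub_mem hQS (hτS Q))
  rw [← hJ]
  unfold Jac
  rw [map_sub, map_sub, chain τ 0 Q, chain τ 1 Q, τ0, τ1]
  simp only [pderiv_C_mul, map_sub, pderiv_C, map_zero]
  ring

/-- Linear change of coordinates. -/
noncomputable def lin : MvPolynomial (Fin 2) ℂ →ₐ[ℂ] MvPolynomial (Fin 2) ℂ :=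
  aeval ![X 0 + X 1, X 0 - X 1]

/-- Reflection in the line. -/
noncomputable def refl2 : MvPolynomial (Fin 2) ℂ →ₐ[ℂ] MvPolynomial (Fin 2) ℂ :=
  aeval ![X 0, - X 1]

lemma lin_exch (p : MvPolynomial (Fin 2) ℂ) : lin (exch ℂ p) = refl2 (lin p) := by
  have : lin.comp (exch ℂ : MvPolynomial (Fin 2) ℂ →ₐ[ℂ] MvPolynomial (Fin 2) ℂ)
      = refl2.comp lin := by
    apply MvPolynomial.algHom_ext
    intro i
    fin_cases i <;> simp [lin, refl2, exch, sub_eq_add_neg]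
  exact DFunLike.congr_fun this p

lemma res_refl2 (p : MvPolynomial (Fin 2) ℂ) : resLine (refl2 p) = resLine p := by
  have : resLine.comp refl2 = resLine := by
    apply MvPolynomial.algHom_ext
    intro i
    fin_cases i <;> simp [resLine, refl2]
  exact DFunLike.congr_fun this p

lemma sym_res {p : MvPolynomial (Fin 2) ℂ} (h : refl2 p = p) : resLine (pderiv 1 p) = 0 := by
  have h1 : pderiv 1 p = - refl2 (pderiv 1 p) := by
    have := chain refl2 1 p
    rw [h] at this
    simpa [refl2, pderiv_X] using this
  have h2 := congrArg resLine h1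
  rw [map_neg, res_refl2] at h2
  exact self_eq_neg.1 h2

lemma skew_res {p : MvPolynomial (Fin 2) ℂ} (h : refl2 p = -p) : resLine p = 0 := by
  have h2 := congrArg resLine h
  rw [map_neg, res_refl2] at h2
  exact self_eq_neg.1 h2

lemma inj_of_surj {R : Type*} [CommRing R] [IsNoetherianRing R] (g : R →+* R)
    (hg : Function.Surjective g) : Function.Injective g := by
  have hit : ∀ n, Function.Surjective (g ^ n : R →+* R) := by
    intro n; rw [RingHom.coe_pow]; exact hg.iterate n
  let K : ℕ →o Ideal R := ⟨fun n => RingHom.ker (g ^ n : R →+* R), by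
    refine monotone_nat_of_le_succ fun n x hx => ?_
    rw [RingHom.mem_ker] at hx ⊢
    rw [pow_succ', RingHom.mul_def, RingHom.comp_apply, hx, map_zero]⟩
  obtain ⟨n, hn⟩ := monotone_stabilizes_iff_noetherian.2 (inferInstance : IsNoetherian R R) K
  rw [injective_iff_map_eq_zero]
  intro x hx
  obtain ⟨y, rfl⟩ := hit n x
  have hy : y ∈ K (n + 1) := by
    change y ∈ RingHom.ker (g ^ (n + 1) : R →+* R)
    rw [RingHom.mem_ker, pow_succ']
    exact hx
  rw [← hn (n + 1) (Nat.le_succ n)] at hy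
  exact hy

/-- Over `ℂ`: if `Jac(P,Q)` is a nonzero scalar and one of `P, Q` is symmetric
or skew-symmetric with respect to `α`, then `f` is an automorphism. -/
theorem stmt14
    (f : MvPolynomial (Fin 2) ℂ →ₐ[ℂ] MvPolynomial (Fin 2) ℂ)
    (hJac : ∃ c : ℂ, c ≠ 0 ∧ Jac (f (X 0)) (f (X 1)) = C c)
    (hsym : exch ℂ (f (X 0)) = f (X 0) ∨ exch ℂ (f (X 0)) = - f (X 0) ∨
            exch ℂ (f (X 1)) = f (X 1) ∨ exch ℂ (f (X 1)) = - f (X 1)) :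
    Function.Bijective f := by
  obtain ⟨c, hc, hJ⟩ := hJac
  have hJ1 : Jac (lin (f (X 0))) (lin (f (X 1))) = C (c * (-2)) := by
    rw [Jac_chain, hJ]
    have h1 : lin (C c) = C c := by rw [← algebraMap_eq, AlgHom.commutes]
    have h2 : Jac (lin (X 0)) (lin (X 1)) = C (-2) := by
      have h3 : (C (-2) : MvPolynomial (Fin 2) ℂ) = -2 := by
        rw [C_neg]; rfl
      rw [h3]
      simp [Jac, lin, pderiv_X]
      norm_num
    rw [h1, h2, C_mul]
  have hc1 : c * (-2) ≠ 0 := mul_ne_zero hc (by norm_num)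
  have hJ2 : Jac (lin (f (X 1))) (lin (f (X 0))) = C (-(c * (-2))) := by
    rw [Jac_swap, hJ1, C_neg]
  have hc2 := neg_ne_zero.2 hc1
  let S := (lin.comp f).range
  have hP : lin (f (X 0)) ∈ S := ⟨X 0, rfl⟩
  have hQ : lin (f (X 1)) ∈ S := ⟨X 1, rfl⟩
  have hS : S = ⊤ := by
    rcases hsym with h | h | h | h
    · exact main_sym _ _ _ hc1 hJ1 (sym_res (by rw [← lin_exch, h])) S hP hQ
    · exact main_line _ _ _ hc2 hJ2 (skew_res (by rw [← lin_exch, h, map_neg])) S hQ hP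
    · exact main_sym _ _ _ hc2 hJ2 (sym_res (by rw [← lin_exch, h])) S hQ hP
    · exact main_line _ _ _ hc1 hJ1 (skew_res (by rw [← lin_exch, h, map_neg])) S hP hQ
  have hsurj : Function.Surjective (lin.comp f) := (AlgHom.range_eq_top _).1 hS
  have hlin : Function.Surjective lin := fun z => by
    obtain ⟨w, hw⟩ := hsurj z
    exact ⟨f w, hw⟩
  have hlini : Function.Injective lin := inj_of_surj lin.toRingHom hlin
  have hf : Function.Surjective f := fun z => by
    obtain ⟨w, hw⟩ := hsurj (lin z)
    exact ⟨w, hlini hw⟩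
  exact ⟨inj_of_surj f.toRingHom hf, hf⟩
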